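/- arXiv:1601.04692 — 4 statements merged into one kernel-verified Lean document; each statement's English description precedes it below -/
import Mathlib

section
/- Let G = (V,W) be a weighted graph with |V| = m, let L = D − W be its unnormalized Laplacian, and suppose the eigenvalues of L are 0 = λ_1 < λ_2 ≤ λ_3 ≤ … ≤ λ_m (so the underlying graph is connected). Then for n with n + 1 ≤ m, the minimal energy tr(Rᵀ L R) over all balanced orthogonal graph drawings R in ℝ^n — i.e. over all m×n real matrices R with Rᵀ R = I_n and 𝟏ᵀ R = 0 — equals λ_2 + ⋯ + λ_{n+1}. Moreover, the m×n matrix R whose columns are any orthonormal eigenvectors u_2,…,u_{n+1} of L associated with λ_2 ≤ … ≤ λ_{n+1} satisfies Rᵀ R = I_n, 𝟏ᵀ R = 0, and achieves this minimum. -/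
open Matrix Finset

/-- A weighted sum with weights of total mass `S.card`, at most `1` on `S`, is at least the sum over
`S` when the values on `S` lie below a threshold and those off `S` carrying weight lie above it. -/
theorem sum_le_sum_mul_of_threshold {ι : Type*} [Fintype ι] [DecidableEq ι] (S : Finset ι)
    (a p : ι → ℝ) (μ : ℝ) (ha : ∀ i ∈ S, a i ≤ μ) (hp : ∀ i ∈ S, p i ≤ 1)
    (hc : ∀ i ∉ S, 0 ≤ (a i - μ) * p i) (hsum : ∑ i, p i = S.card) :
    ∑ i ∈ S, a i ≤ ∑ i, a i * p i := by
  have key : 0 ≤ ∑ i, (a i - μ) * (p i - if i ∈ S then 1 else 0) := by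
    refine Finset.sum_nonneg fun i _ => ?_
    by_cases hi : i ∈ S
    · simpa [hi] using mul_nonneg_of_nonpos_of_nonpos (sub_nonpos.2 (ha i hi))
        (sub_nonpos.2 (hp i hi))
    · simpa [hi] using hc i hi
  simp only [sub_mul, mul_sub, Finset.sum_sub_distrib, ← Finset.mul_sum, hsum, mul_ite, mul_one,
    mul_zero, Finset.sum_ite_mem, Finset.univ_inter] at key
  simp only [Finset.sum_const, nsmul_eq_mul] at key
  linarith

/-- The rows of a real matrix with orthonormal columns have norm at most one. -/
theorem sum_row_sq_le_one {ι κ : Type*} [Fintype ι] [Fintype κ] [DecidableEq κ]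
    (C : Matrix ι κ ℝ) (hC : Cᵀ * C = 1) (i : ι) : ∑ k, C i k ^ 2 ≤ 1 := by
  have hP : C * Cᵀ * (C * Cᵀ)ᵀ = C * Cᵀ := by
    rw [transpose_mul, transpose_transpose, Matrix.mul_assoc, ← Matrix.mul_assoc Cᵀ, hC,
      Matrix.one_mul]
  have hii : (C * Cᵀ) i i = ∑ k, C i k ^ 2 := by simp [Matrix.mul_apply, sq]
  have hsq : ∑ j, (C * Cᵀ) i j ^ 2 = (C * Cᵀ) i i := by
    conv_rhs => rw [← hP]
    rw [Matrix.mul_apply]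
    simp only [transpose_apply, sq]
  have hle : (C * Cᵀ) i i ^ 2 ≤ ∑ j, (C * Cᵀ) i j ^ 2 :=
    Finset.single_le_sum (f := fun j => (C * Cᵀ) i j ^ 2) (fun j _ => sq_nonneg _)
      (Finset.mem_univ i)
  rw [hsq, hii] at hle
  nlinarith

/-- For a connected weighted graph with Laplacian eigenvalues
`0 = λ₁ < λ₂ ≤ … ≤ λ_m` (with orthonormal eigenvectors `u₁, …, u_m`), the minimal
energy `tr(Rᵀ L R)` over all balanced orthogonal drawings `R` in `ℝⁿ`
(`Rᵀ R = I`, `𝟏ᵀ R = 0`) equals `λ₂ + ⋯ + λ_{n+1}`, and the matrix whose columns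
are `u₂, …, u_{n+1}` is such a drawing achieving the minimum. -/
theorem stmt8 (m n : ℕ) (hm : 2 ≤ m) (hmn : n + 1 ≤ m)
    (W : Matrix (Fin m) (Fin m) ℝ)
    (hsymm : W.IsSymm) (hnn : ∀ i j, 0 ≤ W i j) (hdiag : ∀ i, W i i = 0)
    (L : Matrix (Fin m) (Fin m) ℝ)
    (hL : L = Matrix.diagonal (fun i => ∑ j, W i j) - W)
    (lam : Fin m → ℝ) (u : Fin m → (Fin m → ℝ))
    (hortho : ∀ i j, u i ⬝ᵥ u j = if i = j then (1 : ℝ) else 0)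
    (heig : ∀ i, L.mulVec (u i) = lam i • u i)
    (hmono : Monotone lam)
    (h0 : lam ⟨0, by omega⟩ = 0)
    (h1 : 0 < lam ⟨1, by omega⟩)
    (R₀ : Matrix (Fin m) (Fin n) ℝ)
    (hR₀ : ∀ (i : Fin m) (j : Fin n),
      R₀ i j = u ⟨j.1 + 1, Nat.lt_of_lt_of_le (Nat.succ_lt_succ j.isLt) hmn⟩ i) :
    IsLeast { t : ℝ | ∃ R : Matrix (Fin m) (Fin n) ℝ,
        Rᵀ * R = 1 ∧ (∀ k : Fin n, ∑ i, R i k = 0) ∧ t = (Rᵀ * L * R).trace }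
      (∑ j : Fin n, lam ⟨j.1 + 1, Nat.lt_of_lt_of_le (Nat.succ_lt_succ j.isLt) hmn⟩) ∧
    R₀ᵀ * R₀ = 1 ∧ (∀ k : Fin n, ∑ i, R₀ i k = 0) ∧
    (R₀ᵀ * L * R₀).trace =
      ∑ j : Fin n, lam ⟨j.1 + 1, Nat.lt_of_lt_of_le (Nat.succ_lt_succ j.isLt) hmn⟩ := by
  set f : Fin n → Fin m :=
    fun j => ⟨j.1 + 1, Nat.lt_of_lt_of_le (Nat.succ_lt_succ j.isLt) hmn⟩ with hf
  have finj : Function.Injective f := fun a b h => by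
    simpa [hf, Fin.ext_iff] using h
  let z : Fin m := ⟨0, by omega⟩
  have hpos : ∀ i : Fin m, i ≠ z → 0 < lam i := fun i hi =>
    h1.trans_le (hmono (by
      have : i.1 ≠ 0 := fun h => hi (Fin.ext h)
      exact Fin.mk_le_of_le_val (by omega)))
  have hLsymm : Lᵀ = L := by
    rw [hL, transpose_sub, diagonal_transpose, hsymm.eq]
  have hL1 : L *ᵥ 1 = 0 := by
    ext i
    rw [hL, sub_mulVec, Pi.sub_apply, mulVec_diagonal]
    simp [mulVec, dotProduct]
  have hbal : ∀ i, i ≠ z → u i ⬝ᵥ 1 = 0 := fun i hi => by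
    have h : lam i * (u i ⬝ᵥ 1) = 0 := by
      rw [← smul_eq_mul, ← smul_dotProduct, ← heig, ← hLsymm, mulVec_transpose,
        ← dotProduct_mulVec, hL1, dotProduct_zero]
    exact (mul_eq_zero.1 h).resolve_left (hpos i hi).ne'
  let U : Matrix (Fin m) (Fin m) ℝ := of u
  have hUU : U * Uᵀ = 1 := by
    ext i j
    rw [one_apply, ← hortho i j]
    rfl
  have hUU' : Uᵀ * U = 1 := mul_eq_one_comm.1 hUU
  have hLU : L * Uᵀ = Uᵀ * diagonal lam := by
    ext i j
    rw [mul_diagonal, mul_comm]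
    exact congrFun (heig j) i
  have hLdec : L = Uᵀ * diagonal lam * U := by
    rw [← hLU, Matrix.mul_assoc, hUU', Matrix.mul_one]
  have hz : ∀ v : Fin m → ℝ, ∑ i, v i = 0 → u z ⬝ᵥ v = 0 := fun v hv => by
    have hone : (u z ⬝ᵥ 1) • u z = 1 := by
      have h : Uᵀ *ᵥ (U *ᵥ 1) = 1 := by rw [mulVec_mulVec, hUU', one_mulVec]
      have hU1 : U *ᵥ 1 = Pi.single z (u z ⬝ᵥ 1) := by
        ext i
        by_cases hi : i = z
        · subst hi
          simp [U, mulVec]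
        · rw [Pi.single_eq_of_ne hi]
          exact hbal i hi
      rw [hU1, mulVec_single] at h
      conv_rhs => rw [← h]
      ext i
      exact mul_comm _ _
    have h : (u z ⬝ᵥ 1) * (u z ⬝ᵥ v) = 0 := by
      rw [← smul_eq_mul, ← smul_dotProduct, hone, one_dotProduct, hv]
    refine (mul_eq_zero.1 h).resolve_left fun h0 => ?_
    rw [h0, zero_smul] at hone
    exact zero_ne_one (congrFun hone z)
  have hR₀R₀ : R₀ᵀ * R₀ = 1 := by
    ext i j
    simp only [Matrix.mul_apply, transpose_apply, hR₀]
    refine (hortho (f i) (f j)).trans ?_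
    simp [one_apply, finj.eq_iff]
  have hR₀bal : ∀ k : Fin n, ∑ i, R₀ i k = 0 := fun k => by
    simp only [hR₀]
    rw [← hbal (f k) (by simp [hf, z]), dotProduct_one]
  have hR₀tr : (R₀ᵀ * L * R₀).trace = ∑ j, lam (f j) := by
    have hLR : L * R₀ = R₀ * diagonal (lam ∘ f) := by
      ext i j
      rw [mul_diagonal, mul_comm, hR₀, ← smul_eq_mul, Function.comp_apply]
      refine Eq.trans ?_ (congrFun (heig (f j)) i)
      simp only [Matrix.mul_apply, hR₀, hf, mulVec, dotProduct]
    rw [Matrix.mul_assoc, hLR, ← Matrix.mul_assoc, hR₀R₀, Matrix.one_mul, trace_diagonal]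
    rfl
  refine ⟨⟨⟨R₀, hR₀R₀, hR₀bal, hR₀tr.symm⟩, ?_⟩, hR₀R₀, hR₀bal, hR₀tr⟩
  rintro t ⟨R, hR, hRbal, rfl⟩
  let C := U * R
  have hC : Cᵀ * C = 1 := by
    rw [transpose_mul, Matrix.mul_assoc, ← Matrix.mul_assoc Uᵀ, hUU', Matrix.one_mul, hR]
  have htr : (Rᵀ * L * R).trace = ∑ i, lam i * ∑ k, C i k ^ 2 := by
    have : Rᵀ * L * R = Cᵀ * (diagonal lam * C) := by
      simp only [hLdec, C, transpose_mul, Matrix.mul_assoc]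
    rw [this, trace_mul_comm, trace]
    refine Finset.sum_congr rfl fun i _ => ?_
    simp only [diag_apply, Matrix.mul_assoc, diagonal_mul]
    simp [Matrix.mul_apply, sq]
  have hmass : ∑ i, ∑ k, C i k ^ 2 = n := by
    have h := congrArg trace hC
    rw [trace_mul_comm, trace_one, Fintype.card_fin] at h
    rw [← h, trace]
    simp [Matrix.mul_apply, sq]
  have hCz : ∀ k, C z k = 0 := fun k => hz (fun i => R i k) (hRbal k)
  rw [htr]
  let S : Finset (Fin m) := Finset.univ.map ⟨f, finj⟩
  have hS : ∑ j, lam (f j) = ∑ i ∈ S, lam i := by simp [S]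
  rw [hS]
  refine sum_le_sum_mul_of_threshold S lam _ (lam ⟨n, by omega⟩) ?_
    (fun i _ => sum_row_sq_le_one C hC i) ?_ (by simp [S, hmass])
  · intro i hi
    obtain ⟨j, -, rfl⟩ := Finset.mem_map.1 hi
    exact hmono (Fin.mk_le_mk.2 j.isLt)
  · intro i hi
    by_cases hiz : i = z
    · simp [hiz, hCz]
    · refine mul_nonneg (sub_nonneg.2 (hmono ?_)) (Finset.sum_nonneg fun k _ => sq_nonneg _)
      by_contra! hlt
      have hlt' : i.1 < n := hlt
      have hi0 : i.1 ≠ 0 := fun h => hiz (Fin.ext h)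
      refine hi (Finset.mem_map.2 ⟨⟨i.1 - 1, by omega⟩, Finset.mem_univ _, Fin.ext ?_⟩)
      change i.1 - 1 + 1 = i.1
      omega
end

section
/- Let X and Z be two fixed N×K real matrices, and let U Σ Vᵀ = Zᵀ X be a singular value decomposition of Zᵀ X (U, V ∈ O(K), Σ diagonal with nonnegative entries). Then the minimum of the set { ‖X − ZR‖_F : R ∈ O(K) } is achieved by R = U Vᵀ. -/
open Matrix Finset

/-- The Frobenius norm of a real matrix, `‖A‖_F = √(tr (Aᵀ A))`. -/
noncomputable def froNorm {N K : ℕ} (A : Matrix (Fin N) (Fin K) ℝ) : ℝ :=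
  Real.sqrt ((Aᵀ * A).trace)

/-- The diagonal entries of a matrix with orthonormal columns are at most `1`. -/
lemma diag_le_one_of_transpose_mul_self {n : Type*} [Fintype n] [DecidableEq n]
    {W : Matrix n n ℝ} (hW : Wᵀ * W = 1) (i : n) : W i i ≤ 1 := by
  have h : ∑ j, W j i * W j i = 1 := by
    simpa [Matrix.mul_apply] using congrFun (congrFun hW i) i
  have hi : W i i * W i i ≤ ∑ j, W j i * W j i :=
    Finset.single_le_sum (f := fun j => W j i * W j i)
      (fun j _ => mul_self_nonneg _) (Finset.mem_univ i)
  nlinarith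

/-- Expansion of the squared Frobenius distance from `X` to `Z * R` for orthogonal `R`. -/
lemma trace_transpose_mul_self_sub_mul {m n : Type*} [Fintype m] [Fintype n] [DecidableEq n]
    (X Z : Matrix m n ℝ) {R : Matrix n n ℝ} (hR : Rᵀ * R = 1) :
    ((X - Z * R)ᵀ * (X - Z * R)).trace =
      (Xᵀ * X).trace + (Zᵀ * Z).trace - 2 * (Rᵀ * (Zᵀ * X)).trace := by
  have hcross : (Xᵀ * (Z * R)).trace = (Rᵀ * (Zᵀ * X)).trace := by
    rw [← Matrix.trace_transpose]
    simp only [Matrix.transpose_mul, Matrix.transpose_transpose, Matrix.mul_assoc]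
  have hsq : (Rᵀ * (Zᵀ * (Z * R))).trace = (Zᵀ * Z).trace := by
    rw [Matrix.trace_mul_comm]
    simp only [Matrix.mul_assoc, mul_eq_one_comm.mp hR, Matrix.mul_one]
  simp only [Matrix.transpose_sub, Matrix.transpose_mul, Matrix.sub_mul, Matrix.mul_sub,
    Matrix.trace_sub, Matrix.mul_assoc, hcross, hsq]
  ring

/-- A nonnegative diagonal matrix `S` maximizes `tr (W S)` over orthogonal `W` at `W = 1`. -/
lemma trace_mul_diagonal_le {n : Type*} [Fintype n] [DecidableEq n]
    {W : Matrix n n ℝ} (hW : Wᵀ * W = 1) {σ : n → ℝ} (hσ : ∀ i, 0 ≤ σ i) :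
    (W * Matrix.diagonal σ).trace ≤ (Matrix.diagonal σ).trace := by
  simp only [Matrix.trace, Matrix.diag_apply, Matrix.mul_diagonal, Matrix.diagonal_apply_eq]
  exact Finset.sum_le_sum fun i _ =>
    mul_le_of_le_one_left (hσ i) (diag_le_one_of_transpose_mul_self hW i)

/-- For fixed `N × K` matrices `X` and `Z`, if `U S Vᵀ = Zᵀ X` is an
SVD of `Zᵀ X`, then the minimum of `{ ‖X − Z R‖_F : R ∈ O(K) }` is achieved by
`R = U Vᵀ`. -/
theorem stmt11 (N K : ℕ) (X Z : Matrix (Fin N) (Fin K) ℝ)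
    (U V S : Matrix (Fin K) (Fin K) ℝ)
    (hU : Uᵀ * U = 1) (hV : Vᵀ * V = 1)
    (hS : ∃ σ : Fin K → ℝ, (∀ i, 0 ≤ σ i) ∧ S = Matrix.diagonal σ)
    (hsvd : U * S * Vᵀ = Zᵀ * X) :
    (U * Vᵀ)ᵀ * (U * Vᵀ) = 1 ∧
    ∀ R : Matrix (Fin K) (Fin K) ℝ, Rᵀ * R = 1 →
      froNorm (X - Z * (U * Vᵀ)) ≤ froNorm (X - Z * R) := by
  obtain ⟨σ, hσ, rfl⟩ := hS
  have hVV := mul_eq_one_comm.mp hV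
  have hUV : (U * Vᵀ)ᵀ * (U * Vᵀ) = 1 := by
    rw [Matrix.transpose_mul, Matrix.transpose_transpose, Matrix.mul_assoc,
      ← Matrix.mul_assoc Uᵀ, hU, Matrix.one_mul, hVV]
  refine ⟨hUV, fun R hR => Real.sqrt_le_sqrt ?_⟩
  have hcycle (Q : Matrix (Fin K) (Fin K) ℝ) :
      (Qᵀ * (Zᵀ * X)).trace = (Vᵀ * Qᵀ * U * Matrix.diagonal σ).trace := by
    rw [← hsvd, ← Matrix.mul_assoc, Matrix.trace_mul_comm]
    simp only [Matrix.mul_assoc]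
  have hW : (Vᵀ * Rᵀ * U)ᵀ * (Vᵀ * Rᵀ * U) = 1 := by
    calc (Vᵀ * Rᵀ * U)ᵀ * (Vᵀ * Rᵀ * U) = Uᵀ * (R * (V * Vᵀ) * Rᵀ) * U := by
          simp only [Matrix.transpose_mul, Matrix.transpose_transpose, Matrix.mul_assoc]
      _ = 1 := by
          rw [hVV, Matrix.mul_one, mul_eq_one_comm.mp hR, Matrix.mul_one, hU]
  have hone : Vᵀ * (U * Vᵀ)ᵀ * U = 1 := by
    rw [Matrix.transpose_mul, Matrix.transpose_transpose, ← Matrix.mul_assoc, hV,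
      Matrix.one_mul, hU]
  have hle := trace_mul_diagonal_le hW hσ
  rw [trace_transpose_mul_self_sub_mul X Z hUV, trace_transpose_mul_self_sub_mul X Z hR,
    hcycle, hcycle, hone, Matrix.one_mul]
  linarith
end

section
/- Let G = (V,W) be a signed graph with m nodes containing at least one negative edge, whose underlying graph is connected, and let B be the incidence matrix of any orientation of the underlying graph of G (with entries ±√|w_{ij}| following the signed incidence convention). Then G is balanced if and only if rank(B) = m − 1. Furthermore, if G is balanced, then there is a vector u with u_i ∈ {−1,+1} for all i such that Bᵀ u = 0, and the sets V_1 = {v_i : u_i = −1} and V_2 = {v_i : u_i = +1} form a partition of V witnessing that G is balanced. -/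
open Matrix Finset
open scoped Classical

/-- A signed graph `(V, W)` is balanced if its node set can be partitioned into two
blocks such that every positive edge joins two nodes of the same block and every
negative edge joins nodes of different blocks. -/
def IsBalanced {m : ℕ} (W : Matrix (Fin m) (Fin m) ℝ) : Prop :=
  ∃ V1 : Set (Fin m),
    (∀ i j, 0 < W i j → (i ∈ V1 ↔ j ∈ V1)) ∧
    (∀ i j, W i j < 0 → (i ∈ V1 ↔ j ∉ V1))

/-- A real function on the nodes of a signed graph is sign-compatible if it agrees across
positive edges and changes sign across negative edges. -/
def SignCompatible {V : Type*} (W : Matrix V V ℝ) (u : V → ℝ) : Prop :=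
  ∀ i k, (0 < W i k → u i = u k) ∧ (W i k < 0 → u i = -u k)

/-- A sign-compatible function on a connected signed graph that vanishes at one node is zero. -/
theorem SignCompatible.eq_zero {V : Type*} {W : Matrix V V ℝ} {G : SimpleGraph V}
    (hG : ∀ i j, G.Adj i j → W i j ≠ 0) (hconn : G.Connected) {u : V → ℝ}
    (hu : SignCompatible W u) {i : V} (hi : u i = 0) : u = 0 := by
  funext k
  obtain ⟨p⟩ := hconn.preconnected k i
  induction p with
  | nil => exact hi
  | cons h _ ih =>
    have hk := ih hi
    simp only [Pi.zero_apply] at hk ⊢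
    rcases (hG _ _ h).lt_or_gt with hw | hw
    · rw [(hu _ _).2 hw, hk, neg_zero]
    · rw [(hu _ _).1 hw, hk]

/-- A balanced signed graph has a sign-compatible function with values `1` and `-1`. -/
theorem IsBalanced.exists_signCompatible {m : ℕ} {W : Matrix (Fin m) (Fin m) ℝ}
    (h : IsBalanced W) :
    ∃ u : Fin m → ℝ, (∀ i, u i = 1 ∨ u i = -1) ∧ SignCompatible W u := by
  obtain ⟨S, hpos, hneg⟩ := h
  refine ⟨fun i => if i ∈ S then 1 else -1, fun i => ?_, fun i k => ⟨fun hw => ?_, fun hw => ?_⟩⟩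
  · by_cases hi : i ∈ S <;> simp [hi]
  · simp only [hpos i k hw]
  · by_cases hk : k ∈ S <;> simp [hneg i k hw, hk]

/-- A nowhere vanishing sign-compatible function shows that a signed graph is balanced. -/
theorem SignCompatible.isBalanced {m : ℕ} {W : Matrix (Fin m) (Fin m) ℝ} {u : Fin m → ℝ}
    (hu : SignCompatible W u) (h0 : ∀ i, u i ≠ 0) : IsBalanced W := by
  refine ⟨{i | 0 < u i}, fun i k hw => ?_, fun i k hw => ?_⟩
  · simp only [Set.mem_ofPred_eq, (hu i k).1 hw]
  · simp only [Set.mem_ofPred_eq, (hu i k).2 hw, not_lt, neg_pos]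
    exact ⟨le_of_lt, fun h => lt_of_le_of_ne h (h0 k)⟩

/-- The kernel of the transposed incidence matrix consists of the sign-compatible functions. -/
theorem transpose_mulVec_eq_zero_iff_signCompatible {V E : Type*} [Fintype V] [DecidableEq V]
    {W : Matrix V V ℝ} (hsymm : W.IsSymm) (hdiag : ∀ i, W i i = 0) {src tgt : E → V}
    (hedge : ∀ j, W (src j) (tgt j) ≠ 0)
    (hcover : ∀ i k, W i k ≠ 0 → ∃ j, (src j = i ∧ tgt j = k) ∨ (src j = k ∧ tgt j = i))
    {B : Matrix V E ℝ}
    (hB : ∀ i j, B i j =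
      if i = src j then
        (if 0 < W (src j) (tgt j) then Real.sqrt (W (src j) (tgt j))
         else Real.sqrt (-W (src j) (tgt j)))
      else if i = tgt j then
        (if 0 < W (src j) (tgt j) then -Real.sqrt (W (src j) (tgt j))
         else Real.sqrt (-W (src j) (tgt j)))
      else 0)
    (u : V → ℝ) : Bᵀ *ᵥ u = 0 ↔ SignCompatible W u := by
  have hne (j : E) : src j ≠ tgt j := fun h => hedge j (by rw [h, hdiag])
  have hsum (j : E) : (Bᵀ *ᵥ u) j = B (src j) j * u (src j) + B (tgt j) j * u (tgt j) := by
    simp only [Matrix.mulVec, dotProduct, Matrix.transpose_apply]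
    refine Fintype.sum_eq_add _ _ (hne j) fun i hi => ?_
    rw [hB, if_neg hi.1, if_neg hi.2, zero_mul]
  have hrow (j : E) : (Bᵀ *ᵥ u) j = 0 ↔
      (0 < W (src j) (tgt j) → u (src j) = u (tgt j)) ∧
        (W (src j) (tgt j) < 0 → u (src j) = -u (tgt j)) := by
    rw [hsum, hB, hB, if_pos rfl, if_neg (hne j).symm, if_pos rfl]
    rcases (hedge j).lt_or_gt with hw | hw
    · have hs : Real.sqrt (-W (src j) (tgt j)) ≠ 0 := (Real.sqrt_pos.2 (neg_pos.2 hw)).ne'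
      simp only [hw, hw.not_gt, if_false, false_imp_iff, true_and, true_imp_iff]
      rw [← mul_add, mul_eq_zero, or_iff_right hs, eq_neg_iff_add_eq_zero]
    · have hs : Real.sqrt (W (src j) (tgt j)) ≠ 0 := (Real.sqrt_pos.2 hw).ne'
      simp only [hw, hw.not_gt, if_true, false_imp_iff, and_true, true_imp_iff]
      rw [neg_mul, ← sub_eq_add_neg, ← mul_sub, mul_eq_zero, or_iff_right hs, sub_eq_zero]
  constructor
  · intro h i k
    by_cases hw : W i k = 0
    · simp [hw]
    have hj (j : E) := (hrow j).1 (congrFun h j)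
    obtain ⟨j, ⟨rfl, rfl⟩ | ⟨rfl, rfl⟩⟩ := hcover i k hw
    · exact hj j
    · rw [hsymm.apply]
      exact ⟨fun h => ((hj j).1 h).symm, fun h => by rw [(hj j).2 h, neg_neg]⟩
  · exact fun h => funext fun j => (hrow j).2 (h _ _)

/-- A connected signed graph with `m` nodes and at least one negative
edge is balanced iff the incidence matrix `B` of any orientation of its underlying
graph has rank `m − 1`. Moreover, if it is balanced then there is `u` with entries
in `{−1, +1}` such that `Bᵀ u = 0`, and the sets `{v_i : u_i = −1}`,
`{v_i : u_i = +1}` form a partition witnessing the balance. -/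
theorem stmt17 (m n : ℕ) (W : Matrix (Fin m) (Fin m) ℝ)
    (hsymm : W.IsSymm) (hdiag : ∀ i, W i i = 0)
    (G : SimpleGraph (Fin m)) (hG : ∀ i j, G.Adj i j ↔ W i j ≠ 0)
    (hconn : G.Connected)
    (hneg : ∃ i j, W i j < 0)
    (src tgt : Fin n → Fin m)
    (hedge : ∀ j, W (src j) (tgt j) ≠ 0)
    (hcover : ∀ i k : Fin m, W i k ≠ 0 →
      ∃! j : Fin n, (src j = i ∧ tgt j = k) ∨ (src j = k ∧ tgt j = i))
    (B : Matrix (Fin m) (Fin n) ℝ)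
    (hB : ∀ i j, B i j =
      if i = src j then
        (if 0 < W (src j) (tgt j) then Real.sqrt (W (src j) (tgt j))
         else Real.sqrt (-W (src j) (tgt j)))
      else if i = tgt j then
        (if 0 < W (src j) (tgt j) then -Real.sqrt (W (src j) (tgt j))
         else Real.sqrt (-W (src j) (tgt j)))
      else 0) :
    (IsBalanced W ↔ B.rank = m - 1) ∧
    (IsBalanced W → ∃ u : Fin m → ℝ,
      (∀ i, u i = 1 ∨ u i = -1) ∧
      Bᵀ.mulVec u = 0 ∧
      (∀ i j, 0 < W i j → u i = u j) ∧
      (∀ i j, W i j < 0 → u i = -u j)) := by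
  have hker := transpose_mulVec_eq_zero_iff_signCompatible hsymm hdiag hedge
    (fun i k h => (hcover i k h).exists) (B := B) (fun i j => by rw [hB])
  have hzero {u : Fin m → ℝ} (hu : SignCompatible W u) {i : Fin m} (hi : u i = 0) : u = 0 :=
    hu.eq_zero (fun i j => (hG i j).1) hconn hi
  obtain ⟨i₀, -⟩ := hneg
  have hm : 0 < m := i₀.pos
  have hdim : B.rank + Module.finrank ℝ (LinearMap.ker Bᵀ.mulVecLin) = m := by
    rw [← Matrix.rank_transpose, Matrix.rank, LinearMap.finrank_range_add_finrank_ker,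
      Module.finrank_fin_fun]
  have hmem (u : Fin m → ℝ) : u ∈ LinearMap.ker Bᵀ.mulVecLin ↔ SignCompatible W u := by
    rw [LinearMap.mem_ker, Matrix.mulVecLin_apply, hker]
  refine ⟨⟨fun hbal => ?_, fun hrank => ?_⟩, fun hbal => ?_⟩
  · obtain ⟨u, hu1, hu⟩ := hbal.exists_signCompatible
    have hui : u i₀ ≠ 0 := by rcases hu1 i₀ with h | h <;> simp [h]
    have hone : Module.finrank ℝ (LinearMap.ker Bᵀ.mulVecLin) = 1 := by
      refine (finrank_eq_one_iff_of_nonzero'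
        (⟨u, (hmem u).2 hu⟩ : LinearMap.ker Bᵀ.mulVecLin) ?_).2 fun v => ?_
      · exact fun h => hui (congrFun (congrArg Subtype.val h) i₀)
      · refine ⟨v.1 i₀ / u i₀, Subtype.ext ?_⟩
        have hc : SignCompatible W ((v.1 i₀ / u i₀) • u - v.1) :=
          (hmem _).1 (Submodule.sub_mem _ (Submodule.smul_mem _ _ ((hmem u).2 hu)) v.2)
        exact sub_eq_zero.1 (hzero hc (i := i₀) (by simp [hui]))
    omega
  · have hpos : 0 < Module.finrank ℝ (LinearMap.ker Bᵀ.mulVecLin) := by omega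
    have := Module.finrank_pos_iff.1 hpos
    obtain ⟨u, hu⟩ := exists_ne (0 : LinearMap.ker Bᵀ.mulVecLin)
    have huc := (hmem _).1 u.2
    exact huc.isBalanced fun i hi => hu (Subtype.ext (hzero huc hi))
  · obtain ⟨u, hu1, hu⟩ := hbal.exists_signCompatible
    exact ⟨u, hu1, (hker u).2 hu, fun i j => (hu i j).1, fun i j => (hu i j).2⟩
end

section
/- Let G = (V,W) be a signed graph whose underlying graph is connected, and let L̄ = D̄ − W be its signed Laplacian. Then L̄ is positive definite if and only if G is not balanced (equivalently, if and only if the underlying graph possesses some cycle with an odd number of negative edges). -/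
open Matrix Finset
open scoped Classical

/-- The number of negative edges (edges `{u,v}` with `W u v < 0`) traversed by a
walk `p` in a graph, counted with multiplicity. -/
noncomputable def negEdgeCount {V : Type*} (W : V → V → ℝ) {G : SimpleGraph V}
    {u v : V} (p : G.Walk u v) : ℕ :=
  (p.darts.filter fun d => decide (W d.toProd.1 d.toProd.2 < 0)).length

section Walks

variable {V : Type*} {W : V → V → ℝ} {G : SimpleGraph V}

lemma negEdgeCount_nil {u : V} : negEdgeCount W (SimpleGraph.Walk.nil : G.Walk u u) = 0 := by
  simp [negEdgeCount]

lemma negEdgeCount_cons {u v w : V} (h : G.Adj u v) (p : G.Walk v w) :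
    negEdgeCount W (SimpleGraph.Walk.cons h p) =
      (if W u v < 0 then 1 else 0) + negEdgeCount W p := by
  by_cases hw : W u v < 0 <;> simp [negEdgeCount, hw, add_comm]

lemma negEdgeCount_append {u v w : V} (p : G.Walk u v) (q : G.Walk v w) :
    negEdgeCount W (p.append q) = negEdgeCount W p + negEdgeCount W q := by
  simp [negEdgeCount, SimpleGraph.Walk.darts_append]

lemma negEdgeCount_reverse (hW : ∀ i j, W i j = W j i) {u v : V} (p : G.Walk u v) :
    negEdgeCount W p.reverse = negEdgeCount W p := by
  induction p with
  | nil => simp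
  | @cons a b c h p ih =>
    rw [SimpleGraph.Walk.reverse_cons, negEdgeCount_append, ih, negEdgeCount_cons,
      negEdgeCount_cons, negEdgeCount_nil, hW b a]
    omega

/-- Along a walk, the block changes exactly at the negative edges. -/
lemma even_negEdgeCount_iff (hG : ∀ i j, G.Adj i j → W i j ≠ 0) {S : Set V}
    (hpos : ∀ i j, 0 < W i j → (i ∈ S ↔ j ∈ S))
    (hneg : ∀ i j, W i j < 0 → (i ∈ S ↔ j ∉ S)) {u v : V} (p : G.Walk u v) :
    Even (negEdgeCount W p) ↔ (u ∈ S ↔ v ∈ S) := by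
  induction p with
  | nil => simp [negEdgeCount_nil]
  | @cons a b c h p ih =>
    rw [negEdgeCount_cons, Nat.even_add, ih]
    rcases lt_or_gt_of_ne (hG a b h) with hw | hw
    · have := hneg a b hw
      simp only [hw, if_true, Nat.not_even_one]
      tauto
    · have := hpos a b hw
      simp only [not_lt.mpr hw.le, if_false, Even.zero]
      tauto

/-- If no closed walk has an odd number of negative edges, the nodes reached from a root by
walks with an even number of negative edges form one block of a balanced partition. -/
lemma exists_partition_of_forall_not_odd (hW : ∀ i j, W i j = W j i)
    (hG : ∀ i j, W i j ≠ 0 → G.Adj i j) (hconn : G.Connected)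
    (hodd : ∀ (v : V) (p : G.Walk v v), ¬ Odd (negEdgeCount W p)) :
    ∃ S : Set V, (∀ i j, 0 < W i j → (i ∈ S ↔ j ∈ S)) ∧
      (∀ i j, W i j < 0 → (i ∈ S ↔ j ∉ S)) := by
  obtain ⟨r⟩ := hconn.nonempty
  have key : ∀ v (p q : G.Walk r v),
      Even (negEdgeCount W p) ↔ Even (negEdgeCount W q) := by
    intro v p q
    have h := hodd r (p.append q.reverse)
    rwa [Nat.not_odd_iff_even, negEdgeCount_append, negEdgeCount_reverse hW,
      Nat.even_add] at h
  let p : ∀ v, G.Walk r v := fun v => (hconn.preconnected r v).some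
  have step : ∀ i j (_ : G.Adj i j), Even (negEdgeCount W (p j)) ↔
      (Even (negEdgeCount W (p i)) ↔ Even (if W i j < 0 then 1 else 0)) := by
    intro i j h
    rw [key j (p j) ((p i).append (SimpleGraph.Walk.cons h .nil)), negEdgeCount_append,
      negEdgeCount_cons, negEdgeCount_nil, Nat.even_add, add_zero]
  refine ⟨{v | Even (negEdgeCount W (p v))}, fun i j hw => ?_, fun i j hw => ?_⟩
  · have := step i j (hG i j hw.ne')
    simp only [not_lt.mpr hw.le, if_false, Even.zero, iff_true] at this
    simp only [Set.mem_ofPred_eq, this]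
  · have := step i j (hG i j hw.ne)
    simp only [hw, if_true, Nat.not_even_one, iff_false] at this
    simp only [Set.mem_ofPred_eq, this, not_not]

end Walks

/-- A connected signed graph is balanced iff no closed walk has an odd number of
negative edges. -/
lemma isBalanced_iff_forall_not_odd {m : ℕ} {W : Matrix (Fin m) (Fin m) ℝ}
    (hsymm : W.IsSymm) {G : SimpleGraph (Fin m)} (hG : ∀ i j, G.Adj i j ↔ W i j ≠ 0)
    (hconn : G.Connected) :
    IsBalanced W ↔ ∀ (v : Fin m) (p : G.Walk v v), ¬ Odd (negEdgeCount W p) := by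
  constructor
  · rintro ⟨S, hpos, hneg⟩ v p
    rw [Nat.not_odd_iff_even,
      even_negEdgeCount_iff (fun i j h => (hG i j).1 h) hpos hneg p]
  · exact exists_partition_of_forall_not_odd (fun i j => hsymm.apply j i)
      (fun i j => (hG i j).2) hconn

lemma two_mul_signedLaplacian_form {m : ℕ} {W : Matrix (Fin m) (Fin m) ℝ}
    (hsymm : W.IsSymm) (x : Fin m → ℝ) :
    2 * (star x ⬝ᵥ ((Matrix.diagonal (fun i => ∑ j, |W i j|) - W) *ᵥ x)) =
      ∑ i, ∑ j, (|W i j| * (x i ^ 2 + x j ^ 2) - 2 * W i j * x i * x j) := by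
  have hW : ∀ i j, W i j = W j i := fun i j => hsymm.apply j i
  have hswap : ∑ i, ∑ j, |W i j| * x j ^ 2 = ∑ i, ∑ j, |W i j| * x i ^ 2 := by
    rw [Finset.sum_comm]
    exact Finset.sum_congr rfl fun i _ => Finset.sum_congr rfl fun j _ => by rw [hW]
  have hform : star x ⬝ᵥ ((Matrix.diagonal (fun i => ∑ j, |W i j|) - W) *ᵥ x) =
      ∑ i, ∑ j, |W i j| * x i ^ 2 - ∑ i, ∑ j, W i j * x i * x j := by
    rw [Matrix.sub_mulVec, dotProduct_sub]
    congr 1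
    · simp only [dotProduct, Matrix.mulVec_diagonal, Finset.sum_mul, Finset.mul_sum,
        Pi.star_apply, star_trivial]
      exact Finset.sum_congr rfl fun i _ => Finset.sum_congr rfl fun j _ => by ring
    · simp only [dotProduct, Matrix.mulVec, Finset.mul_sum, Pi.star_apply, star_trivial]
      exact Finset.sum_congr rfl fun i _ => Finset.sum_congr rfl fun j _ => by ring
  simp only [hform, Finset.sum_sub_distrib, mul_add, Finset.sum_add_distrib, hswap, mul_assoc,
    ← Finset.mul_sum]
  ring

lemma edge_form_nonneg (w a b : ℝ) : 0 ≤ |w| * (a ^ 2 + b ^ 2) - 2 * w * a * b := by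
  rcases abs_cases w with ⟨h, hw⟩ | ⟨h, hw⟩ <;> rw [h]
  · nlinarith [mul_nonneg hw (sq_nonneg (a - b))]
  · nlinarith [mul_nonneg (neg_nonneg.2 hw.le) (sq_nonneg (a + b))]

lemma eq_of_edge_form_eq_zero {w a b : ℝ} (hw : 0 < w)
    (h : |w| * (a ^ 2 + b ^ 2) - 2 * w * a * b = 0) : a = b := by
  rw [abs_of_pos hw] at h
  have h' : w * (a - b) ^ 2 = 0 := by linarith
  simpa [hw.ne', sub_eq_zero] using h'

lemma eq_neg_of_edge_form_eq_zero {w a b : ℝ} (hw : w < 0)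
    (h : |w| * (a ^ 2 + b ^ 2) - 2 * w * a * b = 0) : a = -b := by
  rw [abs_of_neg hw] at h
  have h' : w * (a + b) ^ 2 = 0 := by linarith
  simpa [hw.ne, add_eq_zero_iff_eq_neg] using h'

/-- The signed Laplacian of a connected signed graph is positive definite iff the graph is
not balanced. -/
lemma signedLaplacian_posDef_iff_not_isBalanced {m : ℕ} {W : Matrix (Fin m) (Fin m) ℝ}
    (hsymm : W.IsSymm) {G : SimpleGraph (Fin m)} (hG : ∀ i j, G.Adj i j ↔ W i j ≠ 0)
    (hconn : G.Connected) :
    (Matrix.diagonal (fun i => ∑ j, |W i j|) - W).PosDef ↔ ¬ IsBalanced W := by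
  constructor
  · rintro hpd ⟨S, hpos, hneg⟩
    obtain ⟨r⟩ := hconn.nonempty
    let x : Fin m → ℝ := fun i => if i ∈ S then 1 else -1
    have hx : x ≠ 0 := by
      intro h
      have h0 := congrFun h r
      by_cases hr : r ∈ S <;> simp [x, hr] at h0
    have hform := two_mul_signedLaplacian_form hsymm x
    have hzero : ∑ i, ∑ j, (|W i j| * (x i ^ 2 + x j ^ 2) - 2 * W i j * x i * x j) = 0 := by
      refine Finset.sum_eq_zero fun i _ => Finset.sum_eq_zero fun j _ => ?_
      rcases lt_trichotomy (W i j) 0 with hw | hw | hw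
      · have := hneg i j hw
        rw [abs_of_neg hw]
        by_cases hj : j ∈ S <;> simp only [x, this, hj, not_true, not_false_iff, if_true, if_false]
          <;> ring
      · simp [hw]
      · have := hpos i j hw
        rw [abs_of_pos hw]
        by_cases hj : j ∈ S <;> simp only [x, this, hj, if_true, if_false] <;> ring
    have := hpd.dotProduct_mulVec_pos hx
    linarith
  · intro hb
    refine Matrix.PosDef.of_dotProduct_mulVec_pos ?_ fun x hx => ?_
    · refine Matrix.IsHermitian.sub (Matrix.isHermitian_diagonal _) ?_
      rw [Matrix.IsHermitian, Matrix.conjTranspose_eq_transpose_of_trivial]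
      exact hsymm
    · by_contra hle
      apply hb
      have hform := two_mul_signedLaplacian_form hsymm x
      have hnn : ∀ i, 0 ≤ ∑ j, (|W i j| * (x i ^ 2 + x j ^ 2) - 2 * W i j * x i * x j) :=
        fun i => Finset.sum_nonneg fun j _ => edge_form_nonneg _ _ _
      have hsum : ∑ i, ∑ j, (|W i j| * (x i ^ 2 + x j ^ 2) - 2 * W i j * x i * x j) = 0 :=
        le_antisymm (by linarith) (Finset.sum_nonneg fun i _ => hnn i)
      have hterm : ∀ i j, |W i j| * (x i ^ 2 + x j ^ 2) - 2 * W i j * x i * x j = 0 := by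
        intro i j
        have hi := (Finset.sum_eq_zero_iff_of_nonneg fun i _ => hnn i).1 hsum i (mem_univ i)
        exact (Finset.sum_eq_zero_iff_of_nonneg fun j _ => edge_form_nonneg _ _ _).1 hi j
          (mem_univ j)
      have hwalk : ∀ {u v : Fin m}, G.Walk u v → |x u| = |x v| := by
        intro u v p
        induction p with
        | nil => rfl
        | @cons a b c h p ih =>
          rw [← ih]
          rcases lt_or_gt_of_ne ((hG a b).1 h) with hw | hw
          · rw [eq_neg_of_edge_form_eq_zero hw (hterm a b), abs_neg]
          · rw [eq_of_edge_form_eq_zero hw (hterm a b)]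
      obtain ⟨r, hr⟩ := Function.ne_iff.1 hx
      have hne : ∀ v, x v ≠ 0 := by
        intro v
        obtain ⟨p⟩ := hconn.preconnected r v
        rw [← abs_pos, ← hwalk p]
        exact abs_pos.2 hr
      refine ⟨{v | 0 < x v}, fun i j hw => ?_, fun i j hw => ?_⟩
      · simp only [Set.mem_ofPred_eq, eq_of_edge_form_eq_zero hw (hterm i j)]
      · simp only [Set.mem_ofPred_eq, eq_neg_of_edge_form_eq_zero hw (hterm i j), not_lt,
          Left.neg_pos_iff]
        exact ⟨le_of_lt, fun h => lt_of_le_of_ne h (hne j)⟩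

/-- The signed Laplacian `L̄ = D̄ − W` of a connected signed graph is
positive definite iff the graph is not balanced, equivalently iff the underlying
graph possesses some cycle (closed walk) with an odd number of negative edges. -/
theorem stmt18 (m : ℕ) (W : Matrix (Fin m) (Fin m) ℝ)
    (hsymm : W.IsSymm) (hdiag : ∀ i, W i i = 0)
    (G : SimpleGraph (Fin m)) (hG : ∀ i j, G.Adj i j ↔ W i j ≠ 0)
    (hconn : G.Connected)
    (Lbar : Matrix (Fin m) (Fin m) ℝ)
    (hLbar : Lbar = Matrix.diagonal (fun i => ∑ j, |W i j|) - W) :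
    (Lbar.PosDef ↔ ¬ IsBalanced W) ∧
    (Lbar.PosDef ↔ ∃ (v : Fin m) (p : G.Walk v v), Odd (negEdgeCount W p)) := by
  subst hLbar
  have hpd := signedLaplacian_posDef_iff_not_isBalanced hsymm hG hconn
  refine ⟨hpd, hpd.trans ?_⟩
  rw [isBalanced_iff_forall_not_odd hsymm hG hconn]
  push Not
  rfl
end
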